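/- arXiv:2405.16639 — 3 statements merged into one kernel-verified Lean document; each statement's English description precedes it below -/
import Mathlib

section
/- Let Ω ⊆ ℝ^K be convex and φ: Ω → ℝ strictly convex and continuously differentiable, let D be a probability distribution on Δ × Ω with (X,Y) ~ D, fix a measurable f: Δ → Ω, and set Z := D_φ(Y, f(X)). Define Φ₁ := D_φ(E[Y|X], f(X)), Φ₂ := D_φ(Y, E[Y|X]) − σ²_φ, Γ₁ := ⟨Y − E[Y|X], ∇φ(E[Y|X])⟩, Γ₂ := −⟨Y − E[Y|X], E[∇φ(f(X))]⟩, and Γ₃ := −⟨Y − E[Y|X], ∇φ(f(X)) − E[∇φ(f(X))]⟩. Then Z − σ²_φ = Φ₁ + Φ₂ + Γ₁ + Γ₂ + Γ₃ almost surely; moreover Φ₂, Γ₁, Γ₂, Γ₃ each have mean 0 and Φ₁ ≥ 0. -/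
open MeasureTheory ProbabilityTheory Real
open scoped ENNReal RealInnerProductSpace

noncomputable section

/-- `ℝ^m` with the Euclidean structure. -/
abbrev Euc (m : ℕ) : Type := EuclideanSpace ℝ (Fin m)

/-- The Bregman divergence `D_φ(x, y) = φ x - φ y - ⟪∇φ y, x - y⟫`. -/
def breg {m : ℕ} (φ : Euc m → ℝ) (x y : Euc m) : ℝ :=
  φ x - φ y - ⟪gradient φ y, x - y⟫

/-- A real random variable `X` is sub-Gaussian with parameter `σ` under `μ`:
`E[exp (l (X - E X))] ≤ exp (l² σ² / 2)` for all real `l`. -/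
def SubGaussianPar {α : Type*} [MeasurableSpace α] (μ : Measure α) (X : α → ℝ) (σ : ℝ) : Prop :=
  ∀ l : ℝ, ∫ a, Real.exp (l * (X a - ∫ a', X a' ∂μ)) ∂μ ≤ Real.exp (l ^ 2 * σ ^ 2 / 2)

/-- A distribution on `ℝ^d` satisfies `c`-isoperimetry: every `L`-Lipschitz real-valued
function of the sample is sub-Gaussian with parameter `L √(c/d)`. -/
def Isoperimetric (c : ℝ) (d : ℕ) (μ : Measure (Euc d)) : Prop :=
  ∀ (L : ℝ) (f : Euc d → ℝ), 0 ≤ L → LipschitzWith (Real.toNNReal L) f →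
    SubGaussianPar μ f (L * Real.sqrt (c / d))

/-- `C` is a universal constant such that the product of a bounded uncorrelated factor
`|Z| ≤ M` with a mean-zero `σ`-sub-Gaussian variable is `C·M·σ`-sub-Gaussian. -/
def MultConstGood (C : ℝ) : Prop :=
  0 < C ∧ ∀ (α : Type) [MeasurableSpace α] (μ : Measure α), IsProbabilityMeasure μ →
    ∀ (X Z : α → ℝ) (σ M : ℝ), Measurable X → Measurable Z →
      SubGaussianPar μ X σ → (∫ a, X a ∂μ) = 0 → (∫ a, Z a * X a ∂μ) = 0 →
      (∀ᵐ a ∂μ, |Z a| ≤ M) → SubGaussianPar μ (fun a => Z a * X a) (C * M * σ)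

theorem aux_breg_nonneg {K : ℕ} {Ω : Set (Euc K)} {φ : Euc K → ℝ} (hφ : ConvexOn ℝ Ω φ)
    (hd : Differentiable ℝ φ) {x y : Euc K} (hx : x ∈ Ω) (hy : y ∈ Ω) : 0 ≤ breg φ x y := by
  have hc : ConvexOn ℝ ((AffineMap.lineMap y x : ℝ →ᵃ[ℝ] Euc K) ⁻¹' Ω)
      (φ ∘ (AffineMap.lineMap y x : ℝ →ᵃ[ℝ] Euc K)) := hφ.comp_affineMap _
  have hl : HasDerivAt (AffineMap.lineMap y x : ℝ →ᵃ[ℝ] Euc K) (x - y) 0 :=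
    AffineMap.hasDerivAt_lineMap
  have hg : HasFDerivAt φ (fderiv ℝ φ y) ((AffineMap.lineMap y x : ℝ →ᵃ[ℝ] Euc K) 0) := by
    rw [AffineMap.lineMap_apply_zero]
    exact (hd y).hasFDerivAt
  have h := hg.comp_hasDerivAt (0 : ℝ) hl
  have h2 := hc.le_slope_of_hasDerivAt (x := 0) (y := 1) (by simpa using hy) (by simpa using hx)
    one_pos h
  have h3 : fderiv ℝ φ y (x - y) = ⟪gradient φ y, x - y⟫ := by
    rw [← toDual_gradient, InnerProductSpace.toDual_apply_apply]
  simp only [slope_def_field, Function.comp_apply, AffineMap.lineMap_apply_one,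
    AffineMap.lineMap_apply_zero, sub_zero, div_one] at h2
  unfold breg
  rw [← h3]
  linarith

theorem aux_mean_zero {d K : ℕ} {Ω : Set (Euc K)} (hΩc : IsCompact Ω)
    (D : Measure (Euc d × Euc K)) [IsProbabilityMeasure D]
    (hsupp : ∀ᵐ q ∂D, q.2 ∈ Ω)
    (η : Euc d → Euc K) (hη : Measurable η) (hηΩ : ∀ x, η x ∈ Ω)
    (hver : (fun q : Euc d × Euc K => η q.1) =ᵐ[D]
      D[(fun q : Euc d × Euc K => q.2) | MeasurableSpace.comap Prod.fst inferInstance])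
    (g : Euc d → Euc K) (hg : Measurable g) (c : ℝ) (hgc : ∀ x, ‖g x‖ ≤ c) :
    ∫ q, ⟪q.2 - η q.1, g q.1⟫ ∂D = 0 := by
  have hm : MeasurableSpace.comap (Prod.fst : Euc d × Euc K → Euc d) inferInstance ≤
      (inferInstance : MeasurableSpace (Euc d × Euc K)) := measurable_fst.comap_le
  obtain ⟨R, hR⟩ := hΩc.isBounded.exists_norm_le
  have hY : Integrable (fun q : Euc d × Euc K => q.2) D :=
    Integrable.of_bound measurable_snd.aestronglyMeasurable R
      (hsupp.mono fun q hq => hR _ hq)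
  have hE : Integrable (fun q : Euc d × Euc K => η q.1) D :=
    Integrable.of_bound (hη.comp measurable_fst).aestronglyMeasurable R
      (ae_of_all _ fun q => hR _ (hηΩ _))
  have hgm : StronglyMeasurable[MeasurableSpace.comap
      (Prod.fst : Euc d × Euc K → Euc d) inferInstance] (fun q : Euc d × Euc K => g q.1) :=
    (hg.comp (comap_measurable Prod.fst)).stronglyMeasurable
  have hga : AEStronglyMeasurable (fun q : Euc d × Euc K => g q.1) D :=
    (hg.comp measurable_fst).aestronglyMeasurable
  have key := condExp_stronglyMeasurable_bilin_of_bound (innerSL ℝ) hm hgm hY c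
    (ae_of_all D fun q => hgc q.1)
  have h1 : Integrable (fun q : Euc d × Euc K => innerSL ℝ (g q.1) q.2) D :=
    (innerSL ℝ).integrable_of_bilin_of_bdd_left c hga (ae_of_all D fun q => hgc q.1) hY
  have h2 : Integrable (fun q : Euc d × Euc K => innerSL ℝ (g q.1) (η q.1)) D :=
    (innerSL ℝ).integrable_of_bilin_of_bdd_left c hga (ae_of_all D fun q => hgc q.1) hE
  have h3 : ∫ q, innerSL ℝ (g q.1) q.2 ∂D = ∫ q, innerSL ℝ (g q.1) (η q.1) ∂D := by
    rw [← integral_condExp hm]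
    refine integral_congr_ae ?_
    filter_upwards [key, hver] with q hq1 hq2
    rw [hq1, ← hq2]
  have h4 : ∀ q : Euc d × Euc K, ⟪q.2 - η q.1, g q.1⟫ =
      innerSL ℝ (g q.1) q.2 - innerSL ℝ (g q.1) (η q.1) := by
    intro q
    rw [← map_sub, innerSL_apply_apply, real_inner_comm]
  simp_rw [h4]
  rw [integral_sub h1 h2, h3, sub_self]

/-- **Bias–variance type decomposition of the Bregman loss.**
`Z − σ²_φ = Φ₁ + Φ₂ + Γ₁ + Γ₂ + Γ₃` almost surely, the terms `Φ₂, Γ₁, Γ₂, Γ₃` have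
mean zero, and `Φ₁ ≥ 0` almost surely. -/
theorem bregman_decomposition (d K : ℕ) (Δ : Set (Euc d)) (Ω : Set (Euc K))
    (hΩconv : Convex ℝ Ω) (hΩc : IsCompact Ω)
    (φ : Euc K → ℝ) (hφ : StrictConvexOn ℝ Ω φ) (hφd : ContDiff ℝ 1 φ)
    (D : Measure (Euc d × Euc K)) [IsProbabilityMeasure D]
    (hsupp : ∀ᵐ q ∂D, q.1 ∈ Δ ∧ q.2 ∈ Ω)
    (η : Euc d → Euc K) (hη : Measurable η) (hηΩ : ∀ x, η x ∈ Ω)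
    (hver : (fun q : Euc d × Euc K => η q.1) =ᵐ[D]
      D[(fun q : Euc d × Euc K => q.2) | MeasurableSpace.comap Prod.fst inferInstance])
    (f : Euc d → Euc K) (hf : Measurable f) (hfΩ : ∀ x, f x ∈ Ω) :
    let σ2 : ℝ := ∫ q, breg φ q.2 (η q.1) ∂D
    let Z : Euc d × Euc K → ℝ := fun q => breg φ q.2 (f q.1)
    let Φ₁ : Euc d × Euc K → ℝ := fun q => breg φ (η q.1) (f q.1)
    let Φ₂ : Euc d × Euc K → ℝ := fun q => breg φ q.2 (η q.1) - σ2
    let Γ₁ : Euc d × Euc K → ℝ := fun q => ⟪q.2 - η q.1, gradient φ (η q.1)⟫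
    let Γ₂ : Euc d × Euc K → ℝ := fun q =>
      -⟪q.2 - η q.1, ∫ q', gradient φ (f q'.1) ∂D⟫
    let Γ₃ : Euc d × Euc K → ℝ := fun q =>
      -⟪q.2 - η q.1, gradient φ (f q.1) - ∫ q', gradient φ (f q'.1) ∂D⟫
    (∀ᵐ q ∂D, Z q - σ2 = Φ₁ q + Φ₂ q + Γ₁ q + Γ₂ q + Γ₃ q) ∧
    (∫ q, Φ₂ q ∂D) = 0 ∧ (∫ q, Γ₁ q ∂D) = 0 ∧ (∫ q, Γ₂ q ∂D) = 0 ∧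
    (∫ q, Γ₃ q ∂D) = 0 ∧ (∀ᵐ q ∂D, 0 ≤ Φ₁ q) := by
  intro σ2 Z Φ₁ Φ₂ Γ₁ Γ₂ Γ₃
  have hs : ∀ᵐ q ∂D, q.2 ∈ Ω := hsupp.mono fun q hq => hq.2
  have hgc : Continuous (gradient φ) :=
    (InnerProductSpace.toDual ℝ (Euc K)).symm.continuous.comp (hφd.continuous_fderiv one_ne_zero)
  obtain ⟨R, hR⟩ := (hΩc.image hgc).isBounded.exists_norm_le
  have hRb : ∀ y ∈ Ω, ‖gradient φ y‖ ≤ R := fun y hy => hR _ ⟨y, hy, rfl⟩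
  have mz := aux_mean_zero hΩc D hs η hη hηΩ hver
  refine ⟨ae_of_all _ fun q => ?_, ?_, ?_, ?_, ?_, ae_of_all _ fun q => ?_⟩
  · simp only [Z, Φ₁, Φ₂, Γ₁, Γ₂, Γ₃, breg, inner_sub_left, inner_sub_right,
      real_inner_comm (gradient φ (η q.1)), real_inner_comm (gradient φ (f q.1))]
    ring
  · have hφc := hφd.continuous
    have hint : Integrable (fun q : Euc d × Euc K => breg φ q.2 (η q.1)) D := by
      have hbc : Continuous (fun p : Euc K × Euc K => breg φ p.1 p.2) := by
        unfold breg
        fun_prop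
      obtain ⟨S, hS⟩ := ((hΩc.prod hΩc).image hbc).isBounded.exists_norm_le
      refine Integrable.of_bound (hbc.measurable.comp
        (measurable_snd.prodMk (hη.comp measurable_fst))).aestronglyMeasurable S ?_
      exact hs.mono fun q hq => hS _ ⟨(q.2, η q.1), ⟨hq, hηΩ _⟩, rfl⟩
    simp only [Φ₂]
    rw [integral_sub hint (integrable_const _)]
    simp [σ2]
  · exact mz (fun x => gradient φ (η x)) (hgc.measurable.comp hη) R fun x => hRb _ (hηΩ x)
  · simp only [Γ₂]
    rw [integral_neg, mz (fun _ => ∫ q', gradient φ (f q'.1) ∂D) measurable_const _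
      (fun _ => le_rfl), neg_zero]
  · simp only [Γ₃]
    rw [integral_neg, mz (fun x => gradient φ (f x) - ∫ q', gradient φ (f q'.1) ∂D)
      ((hgc.measurable.comp hf).sub_const _) (R + ‖∫ q', gradient φ (f q'.1) ∂D‖)
      (fun x => (norm_sub_le _ _).trans (by gcongr; exact hRb _ (hfΩ x))), neg_zero]
  · exact aux_breg_nonneg hφ.convexOn (hφd.differentiable one_ne_zero) (hηΩ _) (hfΩ _)
end
end

section
/- Let Ω ⊆ ℝ^K be compact convex, φ: Ω → ℝ strictly convex and continuously differentiable, D a distribution on Δ × Ω such that a version of E[Y|X] takes values in A ⊆ Ω with a₀ := sup_{a∈A}‖a‖ and m₀ := max_{ω∈Ω}‖ω‖ finite, and F a class of measurable functions from Δ to Ω with γ := sup_{f∈F, x∈Δ} ‖∇φ(f(x))‖ < ∞. Let (X_i, Y_i)_{i=1}^n be i.i.d. samples from D and for f ∈ F set Γ₂^{(i)}(f) := −⟨Y_i − E[Y_i|X_i], E[∇φ(f(X))]⟩. Then for every ε > 0, Pr[∃ f ∈ F such that (1/n)Σ_{i=1}^n Γ₂^{(i)}(f) ≤ −ε] ≤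 2·exp(−2nε²/M₂²), where M₂ = 6γ(m₀ + a₀). -/
open MeasureTheory ProbabilityTheory Real
open scoped ENNReal RealInnerProductSpace

noncomputable section

lemma cosh_chord {x p q u v : ℝ} (hu : 0 ≤ u) (hv : 0 ≤ v) (huv : u + v = 1)
    (h : x ^ 2 ≤ u * p ^ 2 + v * q ^ 2) :
    Real.cosh x ≤ u * Real.cosh p + v * Real.cosh q := by
  have h1 := Real.hasSum_cosh x
  have h2 := ((Real.hasSum_cosh p).mul_left u).add ((Real.hasSum_cosh q).mul_left v)
  refine hasSum_le (fun n => ?_) h1 h2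
  have h3 : (x ^ 2) ^ n ≤ (u * p ^ 2 + v * q ^ 2) ^ n := pow_le_pow_left₀ (sq_nonneg x) h n
  have h4 := (convexOn_pow (𝕜 := ℝ) n).2 (x := p ^ 2) (y := q ^ 2) (sq_nonneg p) (sq_nonneg q) hu hv huv
  simp only [smul_eq_mul] at h4
  rw [pow_mul, pow_mul, pow_mul, ← mul_div_assoc, ← mul_div_assoc, ← add_div]
  exact div_le_div_of_nonneg_right (h3.trans h4) (by positivity)

lemma cosh_step {E : Type*} [NormedAddCommGroup E] [InnerProductSpace ℝ E] (s z : E) {b : ℝ}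
    (hb : 0 < b) (hz : ‖z‖ ≤ b) :
    Real.cosh ‖s + z‖ ≤ Real.cosh ‖s‖ * Real.cosh b +
      inner ℝ s z * (Real.sinh ‖s‖ * Real.sinh b / (‖s‖ * b)) := by
  have hsz : ‖s + z‖ ^ 2 = ‖s‖ ^ 2 + 2 * inner ℝ s z + ‖z‖ ^ 2 := norm_add_sq_real s z
  have hz2 : ‖z‖ ^ 2 ≤ b ^ 2 := pow_le_pow_left₀ (norm_nonneg _) hz 2
  have hin : |inner ℝ s z| ≤ ‖s‖ * b :=
    (abs_real_inner_le_norm s z).trans (mul_le_mul_of_nonneg_left hz (norm_nonneg _))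
  set r : ℝ := inner ℝ s z / (‖s‖ * b) with hr
  have hab : 0 ≤ ‖s‖ * b := by positivity
  have hr1 : |r| ≤ 1 := by
    rw [hr, abs_div, abs_of_nonneg hab]
    exact div_le_one_of_le₀ hin hab
  have hri : r * (‖s‖ * b) = inner ℝ s z := by
    by_cases h0 : ‖s‖ * b = 0
    · rw [h0] at hin ⊢
      rw [abs_nonpos_iff.mp hin, mul_zero]
    · rw [hr, div_mul_cancel₀ _ h0]
  obtain ⟨hl, hu⟩ := abs_le.mp hr1
  have key := cosh_chord (x := ‖s + z‖) (p := ‖s‖ + b) (q := ‖s‖ - b) (u := (1 + r) / 2)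
    (v := (1 - r) / 2) (by linarith) (by linarith) (by ring) (by
      rw [hsz, ← hri]; nlinarith)
  rw [Real.cosh_add, Real.cosh_sub] at key
  refine key.trans (le_of_eq ?_)
  have : inner ℝ s z * (Real.sinh ‖s‖ * Real.sinh b / (‖s‖ * b)) =
      r * (Real.sinh ‖s‖ * Real.sinh b) := by rw [hr]; ring
  rw [this]; ring

lemma cosh_int {Q : Type*} [MeasurableSpace Q] (D : Measure Q) [IsProbabilityMeasure D] {m : ℕ}
    (z : Q → Euc m) (hzm : Measurable z) {b : ℝ} (hb : 0 < b) (hz : ∀ᵐ q ∂D, ‖z q‖ ≤ b)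
    (h0 : ∫ q, z q ∂D = 0) (s : Euc m) :
    ∫⁻ q, ENNReal.ofReal (Real.cosh ‖s + z q‖) ∂D ≤
      ENNReal.ofReal (Real.cosh b) * ENNReal.ofReal (Real.cosh ‖s‖) := by
  have hzi : Integrable z D := Integrable.of_bound hzm.aestronglyMeasurable b hz
  set k := Real.sinh ‖s‖ * Real.sinh b / (‖s‖ * b)
  have hi : Integrable (fun q => inner ℝ s (z q) * k) D := (hzi.const_inner s).mul_const k
  have hg : Integrable (fun q => Real.cosh ‖s‖ * Real.cosh b + inner ℝ s (z q) * k) D :=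
    (integrable_const _).add hi
  have hle : ∀ᵐ q ∂D, Real.cosh ‖s + z q‖ ≤
      Real.cosh ‖s‖ * Real.cosh b + inner ℝ s (z q) * k := by
    filter_upwards [hz] with q hq using cosh_step s (z q) hb hq
  calc ∫⁻ q, ENNReal.ofReal (Real.cosh ‖s + z q‖) ∂D
      ≤ ∫⁻ q, ENNReal.ofReal (Real.cosh ‖s‖ * Real.cosh b + inner ℝ s (z q) * k) ∂D := by
        apply lintegral_mono_ae
        filter_upwards [hle] with q hq using ENNReal.ofReal_le_ofReal hq
    _ = ENNReal.ofReal (∫ q, (Real.cosh ‖s‖ * Real.cosh b + inner ℝ s (z q) * k) ∂D) := by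
        rw [ofReal_integral_eq_lintegral_ofReal hg]
        filter_upwards [hle] with q hq using (Real.cosh_pos _).le.trans hq
    _ = ENNReal.ofReal (Real.cosh b * Real.cosh ‖s‖) := by
        rw [integral_add (integrable_const _) hi, integral_mul_const (μ := D) k, integral_inner hzi, h0]
        simp [mul_comm]
    _ = _ := ENNReal.ofReal_mul (Real.cosh_pos _).le

lemma cosh_pi {Q : Type*} [MeasurableSpace Q] (D : Measure Q) [IsProbabilityMeasure D] {m : ℕ}
    (z : Q → Euc m) (hzm : Measurable z) {b : ℝ} (hb : 0 < b) (hz : ∀ᵐ q ∂D, ‖z q‖ ≤ b)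
    (h0 : ∫ q, z q ∂D = 0) (n : ℕ) : ∀ s : Euc m,
    ∫⁻ ω, ENNReal.ofReal (Real.cosh ‖s + ∑ i, z (ω i)‖) ∂(Measure.pi fun _ : Fin n => D) ≤
      ENNReal.ofReal (Real.cosh b) ^ n * ENNReal.ofReal (Real.cosh ‖s‖) := by
  induction n with
  | zero => intro s; simp
  | succ n ih =>
    intro s
    have hmp := (measurePreserving_piFinSuccAbove (fun _ : Fin (n + 1) => D) 0)
    have hG : Measurable (fun p : Q × (Fin n → Q) =>
        ENNReal.ofReal (Real.cosh ‖(s + z p.1) + ∑ i, z (p.2 i)‖)) := by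
      apply ENNReal.measurable_ofReal.comp
      apply Real.measurable_cosh.comp
      fun_prop
    have e1 := hmp.lintegral_comp hG
    have e2 : ∀ ω : Fin (n + 1) → Q, ENNReal.ofReal (Real.cosh ‖s + ∑ i, z (ω i)‖) =
        (fun p : Q × (Fin n → Q) =>
          ENNReal.ofReal (Real.cosh ‖(s + z p.1) + ∑ i, z (p.2 i)‖))
          (MeasurableEquiv.piFinSuccAbove (fun _ => Q) 0 ω) := by
      intro ω
      simp [MeasurableEquiv.piFinSuccAbove, Fin.sum_univ_succ, add_assoc, Fin.tail]
    simp_rw [e2]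
    rw [e1, lintegral_prod _ hG.aemeasurable]
    calc _ ≤ ∫⁻ q, ENNReal.ofReal (Real.cosh b) ^ n * ENNReal.ofReal (Real.cosh ‖s + z q‖) ∂D :=
          lintegral_mono fun q => ih (s + z q)
      _ = ENNReal.ofReal (Real.cosh b) ^ n * ∫⁻ q, ENNReal.ofReal (Real.cosh ‖s + z q‖) ∂D :=
          lintegral_const_mul' _ _ (by finiteness)
      _ ≤ ENNReal.ofReal (Real.cosh b) ^ n *
          (ENNReal.ofReal (Real.cosh b) * ENNReal.ofReal (Real.cosh ‖s‖)) := by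
          gcongr; exact cosh_int D z hzm hb hz h0 s
      _ = _ := by ring

/-- Pinelis' inequality. -/
lemma pinelis {Q : Type*} [MeasurableSpace Q] (D : Measure Q) [IsProbabilityMeasure D] {m : ℕ}
    (z : Q → Euc m) (hzm : Measurable z) {b : ℝ} (hb : 0 < b) (hz : ∀ᵐ q ∂D, ‖z q‖ ≤ b)
    (h0 : ∫ q, z q ∂D = 0) (n : ℕ) {t : ℝ} (ht : 0 < t) :
    (Measure.pi fun _ : Fin n => D) {ω | n * t ≤ ‖∑ i, z (ω i)‖} ≤
      ENNReal.ofReal (2 * Real.exp (-(n * t ^ 2) / (2 * b ^ 2))) := by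
  set l : ℝ := t / b ^ 2 with hl
  have hlpos : 0 < l := by positivity
  have h1 := cosh_pi D (fun q => l • z q) (hzm.const_smul l) (b := l * b) (by positivity)
    (by filter_upwards [hz] with q hq
        rw [norm_smul, Real.norm_of_nonneg hlpos.le]
        exact mul_le_mul_of_nonneg_left hq hlpos.le)
    (by rw [integral_smul, h0, smul_zero]) n 0
  have hsub : {ω : Fin n → Q | n * t ≤ ‖∑ i, z (ω i)‖} ⊆
      {ω | ENNReal.ofReal (Real.exp (l * (n * t)) / 2) ≤
        ENNReal.ofReal (Real.cosh ‖(0 : Euc m) + ∑ i, l • z (ω i)‖)} := by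
    intro ω hω
    simp only [Set.mem_ofPred_eq] at hω ⊢
    apply ENNReal.ofReal_le_ofReal
    rw [zero_add, ← Finset.smul_sum, norm_smul, Real.norm_of_nonneg hlpos.le, Real.cosh_eq]
    have := Real.exp_le_exp.mpr (mul_le_mul_of_nonneg_left hω hlpos.le)
    have := Real.exp_pos (-(l * ‖∑ i, z (ω i)‖))
    linarith
  have hpos : 0 < Real.exp (l * (n * t)) / 2 := by positivity
  refine (measure_mono hsub).trans ?_
  refine (meas_ge_le_lintegral_div (by
      apply Measurable.aemeasurable
      apply ENNReal.measurable_ofReal.comp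
      apply Real.measurable_cosh.comp
      fun_prop) (by simpa using hpos) (by finiteness)).trans ?_
  refine (ENNReal.div_le_div_right h1 _).trans ?_
  rw [norm_zero, Real.cosh_zero, ENNReal.ofReal_one, mul_one,
    ← ENNReal.ofReal_pow (Real.cosh_pos _).le, ← ENNReal.ofReal_div_of_pos hpos]
  apply ENNReal.ofReal_le_ofReal
  rw [div_le_iff₀ hpos]
  calc Real.cosh (l * b) ^ n ≤ Real.exp ((l * b) ^ 2 / 2) ^ n :=
        pow_le_pow_left₀ (Real.cosh_pos _).le (Real.cosh_le_exp_half_sq _) n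
    _ = Real.exp (-(n * t ^ 2) / (2 * b ^ 2) + l * (n * t)) := by
        rw [← Real.exp_nat_mul]; congr 1; rw [hl]; field_simp; ring
    _ = _ := by rw [Real.exp_add]; ring

/-- **Uniform concentration of the `Γ₂` terms over the function class `F`**: except with
probability `2 exp(−2nε²/M₂²)` with `M₂ = 6γ(m₀ + a₀)`, no `f ∈ F` has empirical average
of `Γ₂⁽ⁱ⁾(f) = −⟨Yᵢ − E[Yᵢ|Xᵢ], E[∇φ(f(X))]⟩` below `−ε`. -/
theorem Gamma2_concentration (d K : ℕ) (Δ : Set (Euc d)) (Ω A : Set (Euc K))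
    (hΩconv : Convex ℝ Ω) (hΩc : IsCompact Ω) (hA : A ⊆ Ω)
    (φ : Euc K → ℝ) (hφ : StrictConvexOn ℝ Ω φ) (hφd : ContDiff ℝ 1 φ)
    (D : Measure (Euc d × Euc K)) [IsProbabilityMeasure D]
    (hsupp : ∀ᵐ q ∂D, q.1 ∈ Δ ∧ q.2 ∈ Ω)
    (η : Euc d → Euc K) (hη : Measurable η) (hηA : ∀ x, η x ∈ A)
    (hver : (fun q : Euc d × Euc K => η q.1) =ᵐ[D]
      D[(fun q : Euc d × Euc K => q.2) | MeasurableSpace.comap Prod.fst inferInstance])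
    (a0 m0 γ : ℝ)
    (ha0 : ∀ a ∈ A, ‖a‖ ≤ a0) (hm0 : ∀ ω ∈ Ω, ‖ω‖ ≤ m0)
    (F : Set (Euc d → Euc K)) (hFmeas : ∀ f ∈ F, Measurable f)
    (hFΩ : ∀ f ∈ F, ∀ x ∈ Δ, f x ∈ Ω)
    (hγ : ∀ f ∈ F, ∀ x ∈ Δ, ‖gradient φ (f x)‖ ≤ γ)
    (n : ℕ) (ε : ℝ) (hε : 0 < ε) :
    (Measure.pi fun _ : Fin n => D)
        {ω | ∃ f ∈ F, (1 / (n : ℝ)) * ∑ i,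
            -⟪(ω i).2 - η ((ω i).1), ∫ q, gradient φ (f q.1) ∂D⟫ ≤ -ε} ≤
      ENNReal.ofReal (2 * Real.exp (-(2 * n * ε ^ 2) / (6 * γ * (m0 + a0)) ^ 2)) := by
  rcases F.eq_empty_or_nonempty with hF | ⟨f₀, hf₀⟩
  · simp [hF]
  obtain ⟨q₀, hq₀⟩ := hsupp.exists
  have hγ0 : 0 ≤ γ := (norm_nonneg _).trans (hγ f₀ hf₀ q₀.1 hq₀.1)
  have ha00 : 0 ≤ a0 := (norm_nonneg _).trans (ha0 _ (hηA 0))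
  have hm00 : 0 ≤ m0 := (norm_nonneg _).trans (hm0 _ (hA (hηA 0)))
  by_cases hM : (6 * γ * (m0 + a0)) = 0 ∨ n = 0
  · refine prob_le_one.trans ?_
    have : -(2 * n * ε ^ 2) / (6 * γ * (m0 + a0)) ^ 2 = 0 := by
      rcases hM with h | h <;> simp [h]
    rw [this]; simp
  push Not at hM
  obtain ⟨hM, hn⟩ := hM
  have hγp : 0 < γ := lt_of_le_of_ne hγ0 (by rintro rfl; simp at hM)
  have hbp : 0 < m0 + a0 := lt_of_le_of_ne (by positivity) (by intro h; simp [← h] at hM)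
  have hnp : (0 : ℝ) < n := by exact_mod_cast Nat.pos_of_ne_zero hn
  have hYi : Integrable (fun q : Euc d × Euc K => q.2) D :=
    Integrable.of_bound measurable_snd.aestronglyMeasurable m0 (by
      filter_upwards [hsupp] with q hq using hm0 _ hq.2)
  have hηm : Measurable (fun q : Euc d × Euc K => η q.1) := hη.comp measurable_fst
  have hηi : Integrable (fun q : Euc d × Euc K => η q.1) D :=
    Integrable.of_bound hηm.aestronglyMeasurable a0 (ae_of_all _ fun q => ha0 _ (hηA _))
  have hmean : ∫ q : Euc d × Euc K, (q.2 - η q.1) ∂D = 0 := by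
    rw [integral_sub hYi hηi, integral_congr_ae hver,
      integral_condExp (measurable_fst.comap_le), sub_self]
  have hP := pinelis D (fun q : Euc d × Euc K => q.2 - η q.1) (measurable_snd.sub hηm) hbp (by
      filter_upwards [hsupp] with q hq
      exact (norm_sub_le _ _).trans (add_le_add (hm0 _ hq.2) (ha0 _ (hηA _)))) hmean n
      (t := ε / γ) (by positivity)
  refine (measure_mono ?_).trans (hP.trans ?_)
  · rintro ω ⟨f, hf, h⟩
    have hv : ‖∫ q, gradient φ (f q.1) ∂D‖ ≤ γ := by
      have := norm_integral_le_of_norm_le_const (μ := D) (f := fun q => gradient φ (f q.1))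
        (C := γ) (by filter_upwards [hsupp] with q hq using hγ f hf _ hq.1)
      simpa using this
    rw [Finset.sum_neg_distrib, ← sum_inner] at h
    have hc := (real_inner_le_norm (∑ i, ((ω i).2 - η (ω i).1))
      (∫ q, gradient φ (f q.1) ∂D)).trans (mul_le_mul_of_nonneg_left hv (norm_nonneg _))
    have h' : n * ε ≤ inner ℝ (∑ i, ((ω i).2 - η (ω i).1)) (∫ q, gradient φ (f q.1) ∂D) := by
      rw [mul_neg, neg_le_neg_iff, one_div, ← div_eq_inv_mul, le_div_iff₀ hnp] at h
      linarith
    show (n : ℝ) * (ε / γ) ≤ _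
    rw [← mul_div_assoc, div_le_iff₀ hγp]
    exact h'.trans hc
  · apply ENNReal.ofReal_le_ofReal
    gcongr 2 * Real.exp ?_
    rw [neg_div, neg_div, neg_le_neg_iff]
    have e1 : 2 * n * ε ^ 2 / (6 * γ * (m0 + a0)) ^ 2 =
        (1 / 9) * (n * (ε / γ) ^ 2 / (2 * (m0 + a0) ^ 2)) := by
      field_simp; norm_num
    rw [e1]
    have : 0 ≤ n * (ε / γ) ^ 2 / (2 * (m0 + a0) ^ 2) := by positivity
    linarith
end
end

section
/- Let Ω ⊆ ℝ^K be compact convex with ℓ∞-diameter at most d_Ω and φ: Ω → ℝ strictly convex and continuously differentiable. Let (G_i, X_i, Y_i)_{i=1}^n be i.i.d., where G_i ∈ [r] is the mixture label and Y_i is conditionally independent of G_i given X_i. Let F be a class of measurable functions from Δ ⊆ ℝ^d to Ω with γ := sup_{f∈F, x∈Δ} ‖∇φ(f(x))‖ < ∞. For f ∈ F, define T_{i,ℓ} := −(Y_{i,ℓ} − E[Y_{i,ℓ}|X_i]) and Ṽ(f)_{i,ℓ} := E[∇φ(f(X_i))_ℓ | G_i] − E[∇φ(f(X_i))_ℓ].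 Then for every ℓ ∈ [K] and every ε > 0, Pr[ inf_{f ∈ F} (1/n)Σ_{i=1}^n T_{i,ℓ}·Ṽ(f)_{i,ℓ} ≤ −ε ] ≤ 2r·exp(−nε² / (8γ²·r·d_Ω²)). -/
open MeasureTheory ProbabilityTheory Real
open scoped ENNReal RealInnerProductSpace

noncomputable section

lemma condExp_mul_of_condIndepFun {A : Type*} {m' mA : MeasurableSpace A} [StandardBorelSpace A]
    (hm' : m' ≤ mA) (μ : Measure A) [IsFiniteMeasure μ] {f g : A → ℝ}
    (hf : Measurable f) (hg : Measurable g) (hfi : Integrable f μ) (hgi : Integrable g μ)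
    (hfg : Integrable (fun a => f a * g a) μ)
    (h : CondIndepFun m' hm' f g μ) :
    μ[fun a => f a * g a | m'] =ᵐ[μ] fun a => (μ[f | m']) a * (μ[g | m']) a := by
  have h1 := (condIndepFun_iff_map_prod_eq_prod_map_map hf hg).1 h
  have h2 := ae_of_ae_trim hm' h1
  filter_upwards [h2, condExp_ae_eq_integral_condExpKernel hm' hfi,
    condExp_ae_eq_integral_condExpKernel hm' hgi,
    condExp_ae_eq_integral_condExpKernel hm' hfg] with a ha h3 h4 h5
  rw [h3, h4, h5]
  have h6 : IndepFun f g (condExpKernel μ m' a) := by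
    rw [indepFun_iff_map_prod_eq_prod_map_map hf.aemeasurable hg.aemeasurable]
    rw [Kernel.map_apply _ (hf.prodMk hg), Kernel.prod_apply, Kernel.map_apply _ hf,
      Kernel.map_apply _ hg] at ha
    exact ha
  exact h6.integral_fun_mul_eq_mul_integral hf.aestronglyMeasurable hg.aestronglyMeasurable

lemma integral_mul_sub_condExp_eq_zero {A : Type*} {m' mA : MeasurableSpace A}
    [StandardBorelSpace A]
    (hm' : m' ≤ mA) (μ : Measure A) [IsFiniteMeasure μ] {f g : A → ℝ}
    (hf : Measurable f) (hg : Measurable g) (C : ℝ) (hfC : ∀ a, |f a| ≤ C) (hgi : Integrable g μ)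
    (h : CondIndepFun m' hm' f g μ) :
    ∫ a, f a * (g a - (μ[g | m']) a) ∂μ = 0 := by
  have hfi : Integrable f μ := Integrable.of_bound hf.aestronglyMeasurable C (ae_of_all _ hfC)
  have hfg : Integrable (fun a => f a * g a) μ :=
    hgi.bdd_mul hf.aestronglyMeasurable (ae_of_all _ hfC)
  have hfc : Integrable (fun a => f a * (μ[g | m']) a) μ :=
    integrable_condExp.bdd_mul hf.aestronglyMeasurable (ae_of_all _ hfC)
  have e : (fun a => f a * (g a - (μ[g | m']) a)) =
      fun a => f a * g a - f a * (μ[g | m']) a := by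
    funext a; ring
  rw [e, integral_sub hfg hfc, ← integral_condExp hm' (f := fun a => f a * g a),
    ← integral_condExp hm' (f := fun a => f a * (μ[g | m']) a), sub_eq_zero]
  apply integral_congr_ae
  have h7 : μ[fun a => f a * (μ[g | m']) a | m'] =ᵐ[μ] μ[f | m'] * μ[g | m'] :=
    condExp_mul_of_stronglyMeasurable_right stronglyMeasurable_condExp hfc hfi
  filter_upwards [condExp_mul_of_condIndepFun hm' μ hf hg hfi hgi hfg h, h7] with a h8 h9
  rw [h8, h9]; rfl

lemma numeric_bound (r : ℕ) (hr : 1 ≤ r) (A : ℝ)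
    (h : 2 * (r : ℝ) * Real.exp (-(A / r)) < 1) :
    (2 : ℝ) ^ r * Real.exp (-A) ≤ 2 * r * Real.exp (-(A / r)) := by
  have hr0 : (1 : ℝ) ≤ r := by exact_mod_cast hr
  have hr1 : (0 : ℝ) < r := by linarith
  set u := Real.exp (-(A / r)) with hu
  have hu0 : 0 < u := Real.exp_pos _
  have e : Real.exp (-A) = u ^ r := by
    rw [hu, ← Real.exp_nat_mul]; congr 1; field_simp
  rw [e, ← mul_pow]
  calc (2 * u) ^ r ≤ (2 * u) ^ 1 := by
        apply pow_le_pow_of_le_one (by positivity) _ hr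
        nlinarith
    _ ≤ 2 * r * u := by nlinarith

/-- Hoeffding for sums of iid bounded centred variables, on the product measure. -/
lemma hoeffding_pi {A : Type*} [MeasurableSpace A] (P : Measure A) [IsProbabilityMeasure P]
    (Z : A → ℝ) (hZ : Measurable Z) (D : ℝ) (hD : 0 ≤ D) (hb : ∀ᵐ a ∂P, |Z a| ≤ D)
    (h0 : ∫ a, Z a ∂P = 0) (n : ℕ) (s : ℝ) (hs : 0 ≤ s) :
    (Measure.pi fun _ : Fin n => P) {ω | s ≤ ∑ i, Z (ω i)} ≤
      ENNReal.ofReal (Real.exp (-s ^ 2 / (2 * (n * D ^ 2)))) := by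
  have hsub := hasSubgaussianMGF_of_mem_Icc_of_integral_eq_zero (a := -D) (b := D)
    hZ.aemeasurable (by filter_upwards [hb] with a ha using abs_le.1 ha) h0
  have hind : iIndepFun (fun (i : Fin n) (ω : Fin n → A) => Z (ω i))
      (Measure.pi fun _ : Fin n => P) := iIndepFun_pi (fun _ => hZ.aemeasurable)
  have key := HasSubgaussianMGF.measure_sum_ge_le_of_iIndepFun hind (s := Finset.univ)
    (c := fun _ => (‖D - (-D)‖₊ / 2) ^ 2) (fun i _ => by
      have hmp := measurePreserving_eval (fun _ : Fin n => P) i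
      refine HasSubgaussianMGF.of_map (X := Z) (Y := Function.eval i) hmp.measurable.aemeasurable ?_
      rw [hmp.map_eq]; exact hsub) hs
  rw [← ENNReal.ofReal_toReal (measure_ne_top (Measure.pi fun _ : Fin n => P) _)]
  apply ENNReal.ofReal_le_ofReal
  refine key.trans (le_of_eq ?_)
  congr 2
  simp only [Finset.sum_const, Finset.card_univ, Fintype.card_fin, nsmul_eq_mul]
  push_cast
  rw [Real.norm_of_nonneg (by linarith)]
  ring

lemma coord_centered_bound {A : Type*} {m' mA : MeasurableSpace A}
    (hm' : m' ≤ mA) (μ : Measure A) [IsProbabilityMeasure μ] {g : A → ℝ} (hg : Integrable g μ)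
    (a b D : ℝ) (hab : b - a ≤ D) (hga : ∀ᵐ x ∂μ, a ≤ g x) (hgb : ∀ᵐ x ∂μ, g x ≤ b) :
    ∀ᵐ x ∂μ, |g x - (μ[g | m']) x| ≤ D := by
  have h1 := condExp_mono (m := m') (integrable_const a) hg hga
  have h2 := condExp_mono (m := m') hg (integrable_const b) hgb
  rw [condExp_const hm'] at h1 h2
  filter_upwards [h1, h2, hga, hgb] with x h1 h2 h3 h4
  rw [abs_le]
  constructor <;> linarith

lemma exists_coord_bounds {K : ℕ} (Ω : Set (Euc K)) (hne : Ω.Nonempty) (ℓ : Fin K)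
    (D : ℝ) (hD : ∀ x ∈ Ω, ∀ y ∈ Ω, |x ℓ - y ℓ| ≤ D) :
    ∃ a b : ℝ, b - a ≤ D ∧ ∀ x ∈ Ω, a ≤ x ℓ ∧ x ℓ ≤ b := by
  obtain ⟨x0, hx0⟩ := hne
  set S := (fun x : Euc K => x ℓ) '' Ω with hS
  have hSne : S.Nonempty := ⟨_, x0, hx0, rfl⟩
  have hba : BddAbove S := ⟨x0 ℓ + D, by
    rintro _ ⟨x, hx, rfl⟩
    have := (abs_le.1 (hD x hx x0 hx0)).2
    show x ℓ ≤ _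
    linarith⟩
  have hbb : BddBelow S := ⟨x0 ℓ - D, by
    rintro _ ⟨x, hx, rfl⟩
    have := (abs_le.1 (hD x hx x0 hx0)).1
    show _ ≤ x ℓ
    linarith⟩
  refine ⟨sInf S, sSup S, ?_, fun x hx => ⟨csInf_le hbb ⟨x, hx, rfl⟩, le_csSup hba ⟨x, hx, rfl⟩⟩⟩
  have : sSup S ≤ sInf S + D := by
    apply csSup_le hSne
    rintro _ ⟨x, hx, rfl⟩
    rw [← sub_le_iff_le_add]
    apply le_csInf hSne
    rintro _ ⟨y, hy, rfl⟩
    have := (abs_le.1 (hD x hx y hy)).2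
    show x ℓ - D ≤ y ℓ
    linarith
  linarith

/-- The sign attached to a Boolean. -/
def bsgn (b : Bool) : ℝ := if b then 1 else -1

lemma abs_bsgn (b : Bool) : |bsgn b| = 1 := by
  cases b <;> simp [bsgn]

/-- Pointwise: some sign pattern dominates every bounded label weighting. -/
lemma exists_sign {r n : ℕ} (G : Fin n → Fin r) (T : Fin n → ℝ) :
    ∃ σ : Fin r → Bool, ∀ (v : Fin r → ℝ) (M : ℝ), (∀ g, |v g| ≤ M) →
      -(M * ∑ i, bsgn (σ (G i)) * T i) ≤ ∑ i, T i * v (G i) := by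
  classical
  let S : Fin r → ℝ := fun g => ∑ i with G i = g, T i
  refine ⟨fun g => decide (0 ≤ S g), fun v M hv => ?_⟩
  have fib : ∀ w : Fin r → ℝ, ∑ i, w (G i) * T i = ∑ g, w g * S g := by
    intro w
    rw [← Finset.sum_fiberwise Finset.univ G]
    refine Finset.sum_congr rfl fun g _ => ?_
    rw [Finset.mul_sum]
    refine Finset.sum_congr rfl fun i hi => ?_
    rw [(Finset.mem_filter.1 hi).2]
  have e1 := fib (fun g => bsgn (decide (0 ≤ S g)))
  have e2 : ∑ i, T i * v (G i) = ∑ g, v g * S g := by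
    rw [← fib v]; exact Finset.sum_congr rfl fun i _ => mul_comm _ _
  rw [e1, e2, Finset.mul_sum, ← Finset.sum_neg_distrib]
  refine Finset.sum_le_sum fun g _ => ?_
  have hs : bsgn (decide (0 ≤ S g)) * S g = |S g| := by
    by_cases h : 0 ≤ S g
    · simp [bsgn, h, abs_of_nonneg h]
    · simp [bsgn, h, abs_of_neg (not_le.1 h)]
  rw [hs]
  have h1 : |v g * S g| ≤ M * |S g| := by
    rw [abs_mul]; exact mul_le_mul_of_nonneg_right (hv g) (abs_nonneg _)
  exact (abs_le.1 h1).1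

/-- **Uniform concentration of `(1/n) ∑ᵢ T_{i,ℓ} Ṽ(f)_{i,ℓ}` over `F` in the mixture
model.** Here `T_{i,ℓ} = −(Y_{i,ℓ} − E[Y_{i,ℓ}|Xᵢ])` and
`Ṽ(f)_{i,ℓ} = E[∇φ(f(Xᵢ))_ℓ | Gᵢ] − E[∇φ(f(Xᵢ))_ℓ]`. -/
theorem That_Vtilde_concentration (d K r : ℕ) (Δ : Set (Euc d)) (Ω : Set (Euc K))
    (hΩconv : Convex ℝ Ω) (hΩc : IsCompact Ω)
    (dΩ : ℝ) (hdΩ : ∀ x ∈ Ω, ∀ y ∈ Ω, ∀ ℓ : Fin K, |x ℓ - y ℓ| ≤ dΩ)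
    (φ : Euc K → ℝ) (hφ : StrictConvexOn ℝ Ω φ) (hφd : ContDiff ℝ 1 φ)
    (P : Measure (Fin r × Euc d × Euc K)) [IsProbabilityMeasure P]
    (hsupp : ∀ᵐ q ∂P, q.2.1 ∈ Δ ∧ q.2.2 ∈ Ω)
    (hci : CondIndepFun
      (MeasurableSpace.comap (fun q : Fin r × Euc d × Euc K => q.2.1) inferInstance)
      (measurable_fst.comp measurable_snd).comap_le (fun q => q.1) (fun q => q.2.2) P)
    (η : Euc d → Euc K) (hη : Measurable η)
    (hver : (fun q : Fin r × Euc d × Euc K => η q.2.1) =ᵐ[P]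
      P[(fun q : Fin r × Euc d × Euc K => q.2.2) |
        MeasurableSpace.comap (fun q : Fin r × Euc d × Euc K => q.2.1) inferInstance])
    (F : Set (Euc d → Euc K)) (hFmeas : ∀ f ∈ F, Measurable f)
    (hFΩ : ∀ f ∈ F, ∀ x ∈ Δ, f x ∈ Ω)
    (γ : ℝ) (hγ : ∀ f ∈ F, ∀ x ∈ Δ, ‖gradient φ (f x)‖ ≤ γ)
    (ℓ : Fin K) (n : ℕ) (ε : ℝ) (hε : 0 < ε) :
    (Measure.pi fun _ : Fin n => P)
        {ω | sInf ((fun f : Euc d → Euc K => (1 / (n : ℝ)) * ∑ i,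
            (-((ω i).2.2 ℓ - η ((ω i).2.1) ℓ)) *
              ((∫ q, gradient φ (f q.2.1) ℓ ∂(P[|{q | q.1 = (ω i).1}])) -
                ∫ q, gradient φ (f q.2.1) ℓ ∂P)) '' F) ≤ -ε} ≤
      ENNReal.ofReal (2 * r * Real.exp (-(n * ε ^ 2) / (8 * γ ^ 2 * r * dΩ ^ 2))) := by
  classical
  have hm' := (measurable_fst.comp measurable_snd :
    Measurable (fun q : Fin r × Euc d × Euc K => q.2.1)).comap_le
  -- basic nonemptiness
  obtain ⟨q0, hq0⟩ := hsupp.exists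
  have hr : 1 ≤ r := by have := q0.1.2; omega
  have hrR : (1 : ℝ) ≤ r := by exact_mod_cast hr
  have hD : 0 ≤ dΩ := (abs_nonneg _).trans (hdΩ _ hq0.2 _ hq0.2 ℓ)
  rcases F.eq_empty_or_nonempty with hF | hF
  · have : ¬ (0 ≤ -ε) := by linarith
    simp [hF, this]
  obtain ⟨f0, hf0⟩ := hF
  have hγ0 : 0 ≤ γ := (norm_nonneg _).trans (hγ f0 hf0 _ hq0.1)
  set B : ℝ := 2 * r * Real.exp (-(n * ε ^ 2) / (8 * γ ^ 2 * r * dΩ ^ 2)) with hB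
  by_cases hB1 : 1 ≤ B
  · refine prob_le_one.trans ?_
    rw [← ENNReal.ofReal_one]
    exact ENNReal.ofReal_le_ofReal hB1
  push Not at hB1
  have hne : n ≠ 0 ∧ γ ≠ 0 ∧ dΩ ≠ 0 := by
    by_contra hcon
    have : -(n * ε ^ 2) / (8 * γ ^ 2 * r * dΩ ^ 2) = 0 := by
      by_cases h1 : n = 0
      · simp [h1]
      by_cases h2 : γ = 0
      · simp [h2]
      by_cases h3 : dΩ = 0
      · simp [h3]
      exact absurd ⟨h1, h2, h3⟩ hcon
    rw [hB, this, Real.exp_zero] at hB1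
    linarith
  obtain ⟨hn0, hγne, hDne⟩ := hne
  have hγp : 0 < γ := lt_of_le_of_ne hγ0 (Ne.symm hγne)
  have hDp : 0 < dΩ := lt_of_le_of_ne hD (Ne.symm hDne)
  have hnp : (0 : ℝ) < n := by exact_mod_cast Nat.pos_of_ne_zero hn0
  -- the noise variable
  have hYint : Integrable (fun q : Fin r × Euc d × Euc K => q.2.2) P := by
    obtain ⟨C, hC⟩ := hΩc.isBounded.exists_norm_le
    exact Integrable.of_bound (measurable_snd.comp measurable_snd).aestronglyMeasurable C
      (by filter_upwards [hsupp] with q hq using hC _ hq.2)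
  have hYm : Measurable (fun q : Fin r × Euc d × Euc K => q.2.2 ℓ) := by fun_prop
  have hYℓ : Integrable (fun q : Fin r × Euc d × Euc K => q.2.2 ℓ) P :=
    (EuclideanSpace.proj (𝕜 := ℝ) ℓ).integrable_comp hYint
  have hηℓ : ∀ᵐ q ∂P, η q.2.1 ℓ =
      (P[(fun q : Fin r × Euc d × Euc K => q.2.2 ℓ) |
        MeasurableSpace.comap (fun q : Fin r × Euc d × Euc K => q.2.1) inferInstance]) q := by
    have h1 := (EuclideanSpace.proj (𝕜 := ℝ) ℓ).comp_condExp_comm (m :=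
      MeasurableSpace.comap (fun q : Fin r × Euc d × Euc K => q.2.1) inferInstance) hYint
    filter_upwards [h1, hver] with q h1 h2
    rw [h2]
    exact h1
  obtain ⟨a, b, hab, hΩab⟩ := exists_coord_bounds Ω ⟨_, hq0.2⟩ ℓ dΩ
    (fun x hx y hy => hdΩ x hx y hy ℓ)
  have hTb : ∀ᵐ q ∂P, |q.2.2 ℓ - η q.2.1 ℓ| ≤ dΩ := by
    filter_upwards [hηℓ, coord_centered_bound hm' P hYℓ a b dΩ hab
      (by filter_upwards [hsupp] with q hq using (hΩab _ hq.2).1)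
      (by filter_upwards [hsupp] with q hq using (hΩab _ hq.2).2)] with q h1 h2
    rw [h1]; exact h2
  -- tail bound for each sign pattern
  let Z : (Fin r → Bool) → Fin r × Euc d × Euc K → ℝ := fun σ q =>
    bsgn (σ q.1) * (-(q.2.2 ℓ - η q.2.1 ℓ))
  have hZm : ∀ σ, Measurable (Z σ) := by
    intro σ
    have h1 : Measurable (fun q : Fin r × Euc d × Euc K => bsgn (σ q.1)) :=
      (measurable_of_countable (fun g : Fin r => bsgn (σ g))).comp measurable_fst
    have h2 : Measurable (fun q : Fin r × Euc d × Euc K => η q.2.1 ℓ) := by fun_prop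
    exact h1.mul (hYm.sub h2).neg
  have hZb : ∀ σ, ∀ᵐ q ∂P, |Z σ q| ≤ dΩ := by
    intro σ
    filter_upwards [hTb] with q hq
    simp only [Z, abs_mul, abs_bsgn, abs_neg, one_mul]
    exact hq
  have hZ0 : ∀ σ, ∫ q, Z σ q ∂P = 0 := by
    intro σ
    have hb : Measurable (fun g : Fin r => bsgn (σ g)) := measurable_of_countable _
    have hc : Measurable (fun y : Euc K => y ℓ) := by fun_prop
    have h1 := integral_mul_sub_condExp_eq_zero hm' P (hb.comp measurable_fst) hYm 1
      (fun q => (abs_bsgn _).le) hYℓ (hci.comp hb hc)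
    have h2 : ∫ q, Z σ q ∂P = ∫ q, -(bsgn (σ q.1) * (q.2.2 ℓ -
        (P[(fun q : Fin r × Euc d × Euc K => q.2.2 ℓ) |
        MeasurableSpace.comap (fun q : Fin r × Euc d × Euc K => q.2.1) inferInstance]) q)) ∂P := by
      apply integral_congr_ae
      filter_upwards [hηℓ] with q hq
      simp only [Z, hq]
      ring
    rw [h2, integral_neg]
    exact neg_eq_zero.2 h1
  set s : ℝ := n * ε / (2 * γ) with hs
  have hs0 : 0 ≤ s := by positivity
  have htail := fun σ => hoeffding_pi P (Z σ) (hZm σ) dΩ hD (hZb σ) (hZ0 σ) n s hs0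
  -- the weights
  have hgb : ∀ f ∈ F, ∀ᵐ q ∂P, ‖gradient φ (f q.2.1) ℓ‖ ≤ γ := by
    intro f hf
    filter_upwards [hsupp] with q hq
    exact (PiLp.norm_apply_le _ ℓ).trans (hγ f hf _ hq.1)
  have hw : ∀ f ∈ F, ∀ g : Fin r, |(∫ q, gradient φ (f q.2.1) ℓ ∂(P[|{q | q.1 = g}])) -
      ∫ q, gradient φ (f q.2.1) ℓ ∂P| ≤ 2 * γ := by
    intro f hf g
    have h1 : ‖∫ q, gradient φ (f q.2.1) ℓ ∂P‖ ≤ γ := by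
      have := norm_integral_le_of_norm_le_const (hgb f hf)
      simpa using this
    have h2 : ‖∫ q, gradient φ (f q.2.1) ℓ ∂(P[|{q | q.1 = g}])‖ ≤ γ := by
      have h3 := norm_integral_le_of_norm_le_const
        ((cond_absolutelyContinuous (μ := P) (s := {q | q.1 = g})).ae_le (hgb f hf))
      refine h3.trans ?_
      by_cases h0 : P {q | q.1 = g} = 0
      · rw [cond_eq_zero_of_meas_eq_zero h0]; simpa using hγ0
      · have := cond_isProbabilityMeasure h0
        simp
    rw [Real.norm_eq_abs] at h1 h2
    exact (abs_sub _ _).trans (by linarith)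
  -- the inclusion of events
  have hincl : {ω : Fin n → Fin r × Euc d × Euc K |
      sInf ((fun f : Euc d → Euc K => (1 / (n : ℝ)) * ∑ i,
            (-((ω i).2.2 ℓ - η ((ω i).2.1) ℓ)) *
              ((∫ q, gradient φ (f q.2.1) ℓ ∂(P[|{q | q.1 = (ω i).1}])) -
                ∫ q, gradient φ (f q.2.1) ℓ ∂P)) '' F) ≤ -ε} ⊆
      ⋃ σ : Fin r → Bool, {ω | s ≤ ∑ i, Z σ (ω i)} := by
    intro ω hω
    obtain ⟨σ, hσ⟩ := exists_sign (fun i => (ω i).1)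
      (fun i => -((ω i).2.2 ℓ - η ((ω i).2.1) ℓ))
    refine Set.mem_iUnion.2 ⟨σ, ?_⟩
    show s ≤ ∑ i, Z σ (ω i)
    have hlow : (1 / (n : ℝ)) * -(2 * γ * ∑ i, Z σ (ω i)) ≤ -ε := by
      refine le_trans (le_csInf (Set.Nonempty.image _ ⟨f0, hf0⟩) ?_) hω
      rintro _ ⟨f, hf, rfl⟩
      exact mul_le_mul_of_nonneg_left (hσ (fun g => (∫ q, gradient φ (f q.2.1) ℓ
        ∂(P[|{q | q.1 = g}])) - ∫ q, gradient φ (f q.2.1) ℓ ∂P) (2 * γ) (hw f hf)) (by positivity)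
    rw [hs, div_le_iff₀ (by positivity)]
    rw [one_div, inv_mul_le_iff₀ hnp] at hlow
    linarith
  refine (measure_mono hincl).trans ((measure_iUnion_le _).trans ?_)
  rw [tsum_fintype]
  refine (Finset.sum_le_sum fun σ _ => htail σ).trans ?_
  rw [← ENNReal.ofReal_sum_of_nonneg (fun _ _ => (Real.exp_pos _).le)]
  apply ENNReal.ofReal_le_ofReal
  simp only [Finset.sum_const, Finset.card_univ, Fintype.card_fun, Fintype.card_bool,
    Fintype.card_fin, nsmul_eq_mul]
  push_cast
  have hr0 : (0 : ℝ) < r := by linarith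
  have e1 : -s ^ 2 / (2 * (n * dΩ ^ 2)) = -(n * ε ^ 2 / (8 * γ ^ 2 * dΩ ^ 2)) := by
    rw [hs]; field_simp; norm_num
  have e2 : -(n * ε ^ 2) / (8 * γ ^ 2 * r * dΩ ^ 2) =
      -(n * ε ^ 2 / (8 * γ ^ 2 * dΩ ^ 2) / r) := by
    field_simp
  rw [hB, e2] at hB1 ⊢
  rw [e1]
  exact numeric_bound r hr _ hB1
end
end
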